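/- Let H be a real number with 1/2 < H < 1, let τ, λ ∈ ℝ and ε > 0, and set s₁ = (τ+λ+ε)/√2. Then ∫_{s₁}^{s₁+ε/√2} ( ∫_{s−√2(τ+ε)}^{−s+√2(λ+ε)} ∫_{s−√2(τ+ε)}^{−s+√2(λ+ε)} |y−ỹ|^{2H−2} dỹ dy ) ds = 2^{H−1/2} · ε^{2H+1} / ( (2H+1) · H · (2H−1) ). -/

import Mathlib

open MeasureTheory

/-- Integral of a Riesz kernel over an interval containing the singularity. -/
theorem integral_abs_sub_rpow {a b y p : ℝ} (hp : -1 < p) (hay : a ≤ y) (hyb : y ≤ b) :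
    ∫ z in a..b, |y - z| ^ p = ((y - a) ^ (p + 1) + (b - y) ^ (p + 1)) / (p + 1) := by
  have hp0 : p + 1 ≠ 0 := by linarith
  have hleft : Set.EqOn (fun z => (y - z) ^ p) (fun z => |y - z| ^ p) (Set.uIcc a y) := by
    intro z hz
    rw [Set.uIcc_of_le hay] at hz
    simp only [abs_of_nonneg (sub_nonneg.2 hz.2)]
  have hright : Set.EqOn (fun z => (z - y) ^ p) (fun z => |y - z| ^ p) (Set.uIcc y b) := by
    intro z hz
    rw [Set.uIcc_of_le hyb] at hz
    simp only [abs_sub_comm y z, abs_of_nonneg (sub_nonneg.2 hz.1)]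
  have ileft : IntervalIntegrable (fun z => |y - z| ^ p) volume a y := by
    have h := (intervalIntegral.intervalIntegrable_rpow' hp (a := y - a) (b := 0)).comp_sub_left y
    simp only [sub_sub_cancel, sub_zero] at h
    exact h.congr (hleft.mono Set.uIoc_subset_uIcc)
  have iright : IntervalIntegrable (fun z => |y - z| ^ p) volume y b := by
    have h := (intervalIntegral.intervalIntegrable_rpow' hp (a := 0) (b := b - y)).comp_sub_right y
    simp only [sub_add_cancel, zero_add] at h
    exact h.congr (hright.mono Set.uIoc_subset_uIcc)
  rw [← intervalIntegral.integral_add_adjacent_intervals ileft iright,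
    ← intervalIntegral.integral_congr hleft, ← intervalIntegral.integral_congr hright,
    intervalIntegral.integral_comp_sub_left (fun x => x ^ p) y,
    intervalIntegral.integral_comp_sub_right (fun x => x ^ p) y,
    integral_rpow (Or.inl hp), integral_rpow (Or.inl hp)]
  simp only [sub_self, Real.zero_rpow hp0]
  ring

/-- Double integral of a Riesz kernel over the square of an interval. -/
theorem integral_integral_abs_sub_rpow {a b p : ℝ} (hp : -1 < p) (hab : a ≤ b) :
    ∫ y in a..b, ∫ z in a..b, |y - z| ^ p
      = 2 * (b - a) ^ (p + 2) / ((p + 1) * (p + 2)) := by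
  have hp1 : -1 < p + 1 := by linarith
  have hp1' : p + 1 ≠ 0 := by linarith
  have hp2 : p + 1 + 1 ≠ 0 := by linarith
  have hinner : Set.EqOn (fun y => ∫ z in a..b, |y - z| ^ p)
      (fun y => ((y - a) ^ (p + 1) + (b - y) ^ (p + 1)) / (p + 1)) (Set.uIcc a b) := by
    intro y hy
    rw [Set.uIcc_of_le hab] at hy
    exact integral_abs_sub_rpow hp hy.1 hy.2
  have hcont : Continuous fun x : ℝ => x ^ (p + 1) :=
    Real.continuous_rpow_const (by linarith)
  have ileft : IntervalIntegrable (fun y => (y - a) ^ (p + 1)) volume a b :=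
    (hcont.comp (continuous_id.sub continuous_const)).intervalIntegrable _ _
  have iright : IntervalIntegrable (fun y => (b - y) ^ (p + 1)) volume a b :=
    (hcont.comp (continuous_const.sub continuous_id)).intervalIntegrable _ _
  rw [intervalIntegral.integral_congr hinner, intervalIntegral.integral_div,
    intervalIntegral.integral_add ileft iright,
    intervalIntegral.integral_comp_sub_right (fun x => x ^ (p + 1)) a,
    intervalIntegral.integral_comp_sub_left (fun x => x ^ (p + 1)) b,
    sub_self, sub_self, integral_rpow (Or.inl hp1), Real.zero_rpow hp2]
  rw [show p + 2 = p + 1 + 1 by ring]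
  field_simp
  ring

/-- Exact value of the Riesz-kernel integral over (a parametrization of) the
triangle `D₂`, computing the noise second moment used for the term `I₂`. -/
theorem I2_noise_second_moment (H τ lam ε : ℝ) (hH₁ : 1/2 < H) (hH₂ : H < 1) (hε : 0 < ε) :
    (∫ s in ((τ + lam + ε)/Real.sqrt 2)..((τ + lam + ε)/Real.sqrt 2 + ε/Real.sqrt 2),
      ∫ y in (s - Real.sqrt 2 * (τ + ε))..(-s + Real.sqrt 2 * (lam + ε)),
        ∫ z in (s - Real.sqrt 2 * (τ + ε))..(-s + Real.sqrt 2 * (lam + ε)),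
          |y - z| ^ (2*H - 2)) =
      (2 : ℝ) ^ (H - 1/2) * ε ^ (2*H + 1) / ((2*H + 1) * H * (2*H - 1)) := by
  have hdiv : ∀ x : ℝ, x / Real.sqrt 2 = Real.sqrt 2 * x / 2 := by
    intro x
    rw [div_eq_div_iff (by positivity) two_ne_zero]
    linear_combination -x * Real.mul_self_sqrt (show (0 : ℝ) ≤ 2 by norm_num)
  have hsε : 0 < Real.sqrt 2 * ε := by positivity
  simp only [hdiv]
  have hinner : Set.EqOn
      (fun s => ∫ y in (s - Real.sqrt 2 * (τ + ε))..(-s + Real.sqrt 2 * (lam + ε)),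
        ∫ z in (s - Real.sqrt 2 * (τ + ε))..(-s + Real.sqrt 2 * (lam + ε)), |y - z| ^ (2*H - 2))
      (fun s => (Real.sqrt 2 * (τ + lam + 2 * ε) - 2 * s) ^ (2 * H) / (H * (2 * H - 1)))
      (Set.uIcc (Real.sqrt 2 * (τ + lam + ε) / 2)
        (Real.sqrt 2 * (τ + lam + ε) / 2 + Real.sqrt 2 * ε / 2)) := by
    intro s hs
    rw [Set.uIcc_of_le (by linarith)] at hs
    have hs2 := hs.2
    simp only
    rw [integral_integral_abs_sub_rpow (by linarith) (by linarith),
      show -s + Real.sqrt 2 * (lam + ε) - (s - Real.sqrt 2 * (τ + ε))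
        = Real.sqrt 2 * (τ + lam + 2 * ε) - 2 * s by ring,
      show 2 * H - 2 + 2 = 2 * H by ring, show 2 * H - 2 + 1 = 2 * H - 1 by ring]
    have : 2 * H - 1 ≠ 0 := by linarith
    have : H ≠ 0 := by linarith
    field_simp
  rw [intervalIntegral.integral_congr hinner, intervalIntegral.integral_div,
    intervalIntegral.integral_comp_sub_mul (fun x => x ^ (2 * H)) two_ne_zero,
    show Real.sqrt 2 * (τ + lam + 2 * ε) -
      2 * (Real.sqrt 2 * (τ + lam + ε) / 2 + Real.sqrt 2 * ε / 2) = 0 by ring,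
    show Real.sqrt 2 * (τ + lam + 2 * ε) - 2 * (Real.sqrt 2 * (τ + lam + ε) / 2)
      = Real.sqrt 2 * ε by ring,
    integral_rpow (Or.inl (by linarith)), Real.zero_rpow (by linarith),
    Real.mul_rpow (by positivity) hε.le, Real.sqrt_eq_rpow,
    ← Real.rpow_mul (by norm_num), show 1 / 2 * (2 * H + 1) = H - 1 / 2 + 1 by ring,
    Real.rpow_add_one (by norm_num), smul_eq_mul]
  have : 2 * H - 1 ≠ 0 := by linarith
  have : H ≠ 0 := by linarith
  have : 2 * H + 1 ≠ 0 := by linarith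
  field_simp
  ring
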